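/- Lipschitz estimate for the RNP force integrand: for any functions w₁, w₂ : ℝ^d → ℝ^d and any distinct points x, y ∈ ℝ^d, 2 |ψ'(|y − x| S(y,x;w₁)²) S(y,x;w₁) − ψ'(|y − x| S(y,x;w₂)²) S(y,x;w₂)| ≤ C₂ (|w₁(y) − w₂(y)| + |w₁(x) − w₂(x)|)/|y − x|. -/

import Mathlib

open scoped RealInnerProductSpace

/-- The linearized bond strain `S(y, x; w) = ((w y - w x) ⬝ (y - x)) / |y - x|²`. -/
noncomputable def strain {d : ℕ} (w : EuclideanSpace ℝ (Fin d) → EuclideanSpace ℝ (Fin d))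
    (y x : EuclideanSpace ℝ (Fin d)) : ℝ :=
  ⟪w y - w x, y - x⟫ / ‖y - x‖ ^ 2

/-- A function whose second derivative is bounded by `C` has a `C`-Lipschitz derivative. -/
theorem abs_deriv_sub_le_of_abs_iteratedDeriv_two_le {g : ℝ → ℝ} (hg : ContDiff ℝ 2 g) {C : ℝ}
    (hC : ∀ t, |iteratedDeriv 2 g t| ≤ C) (a b : ℝ) :
    |deriv g a - deriv g b| ≤ C * |a - b| := by
  have hd : Differentiable ℝ (deriv g) := by
    have := hg.differentiable_iteratedDeriv 1 (by norm_num)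
    rwa [iteratedDeriv_one] at this
  refine convex_univ.norm_image_sub_le_of_norm_deriv_le (fun t _ => hd t) (fun t _ => ?_)
    (Set.mem_univ b) (Set.mem_univ a)
  have h := hC t
  rwa [iteratedDeriv_succ, iteratedDeriv_one] at h

/-- If `t ↦ ψ (t ^ 2)` has second derivative bounded by `C`, then `s ↦ 2 ψ' (r s²) s` is
`C`-Lipschitz for every `r > 0`. -/
theorem two_mul_abs_deriv_mul_sq_mul_sub_le {ψ : ℝ → ℝ} (hψ : ContDiff ℝ 2 ψ) {C : ℝ}
    (hC : ∀ t, |iteratedDeriv 2 (fun t => ψ (t ^ 2)) t| ≤ C) {r : ℝ} (hr : 0 < r) (a b : ℝ) :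
    2 * |deriv ψ (r * a ^ 2) * a - deriv ψ (r * b ^ 2) * b| ≤ C * |a - b| := by
  have hderiv (t : ℝ) : deriv (fun t => ψ (t ^ 2)) t = deriv ψ (t ^ 2) * (2 * t) := by
    have h := ((hψ.differentiable (by norm_num)) (t ^ 2)).hasDerivAt.comp t (hasDerivAt_pow 2 t)
    simpa [Function.comp_def] using h.deriv
  have h := abs_deriv_sub_le_of_abs_iteratedDeriv_two_le (hψ.comp (contDiff_id.pow 2)) hC
    (√r * a) (√r * b)
  have hfactor : deriv ψ (r * a ^ 2) * (2 * (√r * a)) - deriv ψ (r * b ^ 2) * (2 * (√r * b)) =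
      √r * (2 * (deriv ψ (r * a ^ 2) * a - deriv ψ (r * b ^ 2) * b)) := by ring
  have hpos : 0 < √r := Real.sqrt_pos.2 hr
  change |deriv (fun t => ψ (t ^ 2)) _ - deriv (fun t => ψ (t ^ 2)) _| ≤ _ at h
  rw [hderiv, hderiv, mul_pow, mul_pow, Real.sq_sqrt hr.le, hfactor, ← mul_sub, abs_mul, abs_mul,
    abs_mul, abs_of_pos hpos, abs_two, mul_left_comm C] at h
  exact le_of_mul_le_mul_left h hpos

theorem abs_strain_sub_strain_le {d : ℕ}
    (w₁ w₂ : EuclideanSpace ℝ (Fin d) → EuclideanSpace ℝ (Fin d))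
    {x y : EuclideanSpace ℝ (Fin d)} (hxy : x ≠ y) :
    |strain w₁ y x - strain w₂ y x| ≤ (‖w₁ y - w₂ y‖ + ‖w₁ x - w₂ x‖) / ‖y - x‖ := by
  have hr : 0 < ‖y - x‖ := norm_pos_iff.2 (sub_ne_zero.2 hxy.symm)
  have hdiff : w₁ y - w₁ x - (w₂ y - w₂ x) = w₁ y - w₂ y - (w₁ x - w₂ x) := by abel
  rw [strain, strain, ← sub_div, ← inner_sub_left, hdiff, abs_div, abs_of_pos (pow_pos hr 2),
    div_le_div_iff₀ (pow_pos hr 2) hr]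
  calc |⟪w₁ y - w₂ y - (w₁ x - w₂ x), y - x⟫| * ‖y - x‖
      ≤ ((‖w₁ y - w₂ y‖ + ‖w₁ x - w₂ x‖) * ‖y - x‖) * ‖y - x‖ := by
        gcongr
        exact (abs_real_inner_le_norm _ _).trans (by gcongr; exact norm_sub_le _ _)
    _ = (‖w₁ y - w₂ y‖ + ‖w₁ x - w₂ x‖) * ‖y - x‖ ^ 2 := by ring

/-- Lipschitz estimate for the RNP force integrand: for `ψ` twice continuously
differentiable with `C₂ = sup_x |(d²/dx²) ψ(x²)| < ∞`, any `w₁, w₂ : ℝ^d → ℝ^d`, and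
distinct points `x ≠ y`,
`2 |ψ'(|y−x| S(y,x;w₁)²) S(y,x;w₁) − ψ'(|y−x| S(y,x;w₂)²) S(y,x;w₂)|
  ≤ C₂ (|w₁(y) − w₂(y)| + |w₁(x) − w₂(x)|)/|y − x|`. -/
theorem force_integrand_lipschitz {d : ℕ} (ψ : ℝ → ℝ) (hψ : ContDiff ℝ 2 ψ) (C₂ : ℝ)
    (hbdd : BddAbove (Set.range fun x => |iteratedDeriv 2 (fun t => ψ (t ^ 2)) x|))
    (hC₂ : C₂ = ⨆ x : ℝ, |iteratedDeriv 2 (fun t => ψ (t ^ 2)) x|)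
    (w₁ w₂ : EuclideanSpace ℝ (Fin d) → EuclideanSpace ℝ (Fin d))
    (x y : EuclideanSpace ℝ (Fin d)) (hxy : x ≠ y) :
    2 * |deriv ψ (‖y - x‖ * strain w₁ y x ^ 2) * strain w₁ y x -
          deriv ψ (‖y - x‖ * strain w₂ y x ^ 2) * strain w₂ y x| ≤
      C₂ * (‖w₁ y - w₂ y‖ + ‖w₁ x - w₂ x‖) / ‖y - x‖ := by
  have hC (t : ℝ) : |iteratedDeriv 2 (fun t => ψ (t ^ 2)) t| ≤ C₂ := hC₂ ▸ le_ciSup hbdd t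
  have hC_nonneg : 0 ≤ C₂ := (abs_nonneg _).trans (hC 0)
  have hr : 0 < ‖y - x‖ := norm_pos_iff.2 (sub_ne_zero.2 hxy.symm)
  rw [mul_div_assoc]
  exact (two_mul_abs_deriv_mul_sq_mul_sub_le hψ hC hr _ _).trans
    (mul_le_mul_of_nonneg_left (abs_strain_sub_strain_le w₁ w₂ hxy) hC_nonneg)
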